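/- Let m be a square-free positive integer with m ≡ 3 (mod 4), let θ = m^(1/4) be the real positive fourth root of m, and let K = ℚ(i, θ). Then K is not monogenic: there is no α in the ring of integers O_K of K such that O_K = ℤ[α] (equivalently, no α ∈ O_K such that {1, α, α², …, α⁷} is an integral basis of K). -/

import Mathlib

open NumberField

/-- The real positive fourth root of `m`, viewed as a complex number. -/
noncomputable def theta (m : ℕ) : ℂ := ((m : ℝ) ^ ((1 : ℝ) / 4) : ℝ)

/-- The octic field `K = ℚ(i, m^(1/4))` as a subfield of `ℂ`. -/
noncomputable def Kfield (m : ℕ) : IntermediateField ℚ ℂ :=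
  IntermediateField.adjoin ℚ {Complex.I, theta m}

/-- A field `L` spanned over `ℚ` by the products `J ^ j * θ ^ k`, where `J ^ 2 = -1` and
`θ ^ 4 = m`, with the two automorphisms generating the dihedral Galois group. -/
structure OcticData (L : Type*) [Field L] (m : ℕ) where
  J : L
  θ : L
  ρ : L →+* L
  τ : L →+* L
  J_sq : J ^ 2 = -1
  θ_pow : θ ^ 4 = m
  ρ_J : ρ J = J
  ρ_θ : ρ θ = J * θ
  τ_J : τ J = -J
  τ_θ : τ θ = θ
  coords : ∀ x : L, ∃ a₀ a₁ a₂ a₃ a₄ a₅ a₆ a₇ : ℚ,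
    x = (a₀ + a₁ * J) + (a₂ + a₃ * J) * θ + (a₄ + a₅ * J) * θ ^ 2 + (a₆ + a₇ * J) * θ ^ 3

theorem IsIntegral.exists_int_of_ratCast {L : Type*} [Field L] [CharZero L] {q : ℚ}
    (h : IsIntegral ℤ (q : L)) : ∃ z : ℤ, q = z := by
  have h' : IsIntegral ℤ (algebraMap ℚ L q) := by simpa using h
  rw [isIntegral_algebraMap_iff (algebraMap ℚ L).injective] at h'
  obtain ⟨z, hz⟩ := IsIntegrallyClosed.isIntegral_iff.mp h'
  exact ⟨z, by simpa using hz.symm⟩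

theorem IsIntegral.of_eq {L : Type*} [Field L] {x y : L} (h : IsIntegral ℤ x) (e : y = x) :
    IsIntegral ℤ y :=
  e ▸ h

theorem IsIntegral.natCast {L : Type*} [Field L] (n : ℕ) : IsIntegral ℤ (n : L) := by
  simpa using isIntegral_algebraMap (R := ℤ) (A := L) (x := (n : ℤ))

theorem IsIntegral.intCast {L : Type*} [Field L] (n : ℤ) : IsIntegral ℤ (n : L) := by
  simpa using isIntegral_algebraMap (R := ℤ) (A := L) (x := n)

/-- A rational number `r` with `r ^ 4 * m ^ 3` an integer, `m` squarefree, is an integer. -/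
theorem Rat.exists_int_of_pow_four_mul {m : ℕ} (hm : Squarefree m) {r : ℚ} {n : ℤ}
    (h : r ^ 4 * m ^ 3 = n) : ∃ z : ℤ, r = z := by
  have hm0 : (m : ℚ) ≠ 0 := by exact_mod_cast hm.ne_zero
  have hi : IsIntegral ℤ (r * m) := by
    refine IsIntegral.of_pow (n := 4) (by norm_num) ?_
    have : (r * m) ^ 4 = ((n * m : ℤ) : ℚ) := by
      push_cast; rw [← h]; ring
    rw [this]; exact IsIntegral.intCast _
  obtain ⟨z, hz⟩ := IsIntegral.exists_int_of_ratCast (L := ℚ) (by simpa using hi)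
  have h4 : z ^ 4 = n * m := by
    have : (z : ℚ) ^ 4 = n * m := by rw [← hz, ← h]; ring
    exact_mod_cast this
  have hsq : Squarefree (m : ℤ) := Int.squarefree_natCast.mpr hm
  have hd : (m : ℤ) ∣ z := (hsq.dvd_pow_iff_dvd four_ne_zero).mp ⟨n, by rw [h4]; ring⟩
  obtain ⟨c, rfl⟩ := hd
  refine ⟨c, ?_⟩
  push_cast at hz
  exact mul_right_cancel₀ hm0 (by rw [hz]; ring)

theorem Int.even_of_sq_add_sq {P Q n : ℤ} (h : P ^ 2 + Q ^ 2 = 4 * n) :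
    (∃ a, P = 2 * a) ∧ ∃ b, Q = 2 * b := by
  have hP := Int.emod_two_eq_zero_or_one P
  have hQ := Int.emod_two_eq_zero_or_one Q
  have eP := Int.emod_add_mul_ediv P 2
  have eQ := Int.emod_add_mul_ediv Q 2
  generalize P / 2 = p at *
  generalize Q / 2 = q at *
  rcases hP with hP | hP <;> rcases hQ with hQ | hQ <;> rw [hP] at eP <;> rw [hQ] at eQ <;>
    subst eP <;> subst eQ <;> ring_nf at h
  · exact ⟨⟨p, by ring⟩, ⟨q, by ring⟩⟩
  all_goals omega

namespace OcticData

variable {L : Type*} [Field L] {m : ℕ} (D : OcticData L m)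

attribute [simp] ρ_J ρ_θ τ_J τ_θ

theorem isIntegral_J : IsIntegral ℤ D.J :=
  IsIntegral.of_pow (n := 2) (by norm_num) (by rw [D.J_sq]; exact isIntegral_one.neg)

theorem isIntegral_θ : IsIntegral ℤ D.θ :=
  IsIntegral.of_pow (n := 4) (by norm_num) (by rw [D.θ_pow]; exact IsIntegral.natCast m)

variable [CharZero L]

theorem one_sub_J_ne_zero : 1 - D.J ≠ 0 := by
  intro h
  have h2 := D.J_sq
  rw [← sub_eq_zero.mp h] at h2
  norm_num at h2

theorem θ_ne_zero (hm : m ≠ 0) : D.θ ≠ 0 := by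
  intro h
  have h2 := D.θ_pow
  rw [h] at h2
  exact hm (by exact_mod_cast (show (m : L) = 0 by rw [← h2]; norm_num))

theorem τ_τ (x : L) : D.τ (D.τ x) = x := by
  obtain ⟨a₀, a₁, a₂, a₃, a₄, a₅, a₆, a₇, rfl⟩ := D.coords x
  simp

theorem ρ_ρ_τ (x : L) : D.ρ (D.ρ (D.τ x)) = D.τ (D.ρ (D.ρ x)) := by
  obtain ⟨a₀, a₁, a₂, a₃, a₄, a₅, a₆, a₇, rfl⟩ := D.coords x
  simp only [map_add, map_mul, map_pow, map_ratCast, ρ_J, ρ_θ, τ_J, τ_θ, map_neg]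
  ring

theorem ρ_ρ_ρ_ρ (x : L) : D.ρ (D.ρ (D.ρ (D.ρ x))) = x := by
  obtain ⟨a₀, a₁, a₂, a₃, a₄, a₅, a₆, a₇, rfl⟩ := D.coords x
  have h : D.J * (D.J * (D.J * (D.J * D.θ))) = D.θ := by
    linear_combination D.θ * (D.J ^ 2 - 1) * D.J_sq
  simp only [map_add, map_mul, map_pow, map_ratCast, ρ_J, ρ_θ, h]

theorem exists_coords_of_ρ {x : L} (h : D.ρ x = x) : ∃ p q : ℚ, x = p + q * D.J := by
  obtain ⟨a₀, a₁, a₂, a₃, a₄, a₅, a₆, a₇, hx⟩ := D.coords x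
  refine ⟨a₀, a₁, ?_⟩
  have e : x + D.ρ x + D.ρ (D.ρ x) + D.ρ (D.ρ (D.ρ x)) = 4 * (a₀ + a₁ * D.J) := by
    rw [hx]
    simp only [map_add, map_mul, map_pow, map_ratCast, ρ_J, ρ_θ]
    linear_combination ((a₂ + a₃ * D.J) * D.θ * (1 + D.J)
      + (a₄ + a₅ * D.J) * D.θ ^ 2 * (1 + D.J ^ 4)
      + (a₆ + a₇ * D.J) * D.θ ^ 3 * (1 + D.J ^ 3) * (1 - D.J ^ 2 + D.J ^ 4)) * D.J_sq
  simp only [h] at e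
  linear_combination e / 4

theorem exists_coords_of_ρ_ρ_τ {x : L} (h : D.ρ (D.ρ x) = x) (h' : D.τ x = x) :
    ∃ p q : ℚ, x = p + q * D.θ ^ 2 := by
  obtain ⟨a₀, a₁, a₂, a₃, a₄, a₅, a₆, a₇, hx⟩ := D.coords x
  refine ⟨a₀, a₄, ?_⟩
  have e : x + D.ρ (D.ρ x) + D.τ x + D.τ (D.ρ (D.ρ x)) = 4 * (a₀ + a₄ * D.θ ^ 2) := by
    rw [hx]
    simp only [map_add, map_mul, map_pow, map_ratCast, ρ_J, ρ_θ, τ_J, τ_θ]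
    linear_combination (2 * a₂ * D.θ + 2 * a₄ * D.θ ^ 2 * (D.J ^ 2 - 1)
      + 2 * a₆ * D.θ ^ 3 * (D.J ^ 4 - D.J ^ 2 + 1)) * D.J_sq
  rw [h, h'] at e
  linear_combination e / 4

/-- In `ℤ[i]`, the prime `1 - i` divides `T` if it divides `T ^ 2`. -/
theorem one_sub_J_dvd_of_ρ {T y : L} (hT : IsIntegral ℤ T) (hy : IsIntegral ℤ y)
    (hρ : D.ρ T = T) (h : T ^ 2 = (1 - D.J) * y) :
    ∃ z, IsIntegral ℤ z ∧ T = (1 - D.J) * z := by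
  obtain ⟨p, q, rfl⟩ := D.exists_coords_of_ρ hρ
  have hJ := D.J_sq
  have iJ := D.isIntegral_J
  have iτ := map_isIntegral_int D.τ hT
  have eτ : D.τ (p + q * D.J) = p - q * D.J := by simp; ring
  have hP : IsIntegral ℤ ((2 * p : ℚ) : L) := by
    refine IsIntegral.of_eq (hT.add iτ) ?_
    rw [eτ]; push_cast; ring
  have hQ : IsIntegral ℤ ((2 * q : ℚ) : L) := by
    refine IsIntegral.of_eq ((iJ.mul (hT.sub iτ)).neg) ?_
    rw [eτ]; push_cast
    linear_combination (2 * q : L) * hJ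
  have hn : IsIntegral ℤ ((p ^ 2 + q ^ 2 : ℚ) : L) := by
    refine IsIntegral.of_eq (hT.mul iτ) ?_
    rw [eτ]; push_cast
    linear_combination (q ^ 2 : L) * hJ
  have hN : IsIntegral ℤ (((p ^ 2 + q ^ 2) ^ 2 / 2 : ℚ) : L) := by
    refine IsIntegral.of_eq (hy.mul (map_isIntegral_int D.τ hy)) ?_
    have h2 := congrArg D.τ h
    rw [map_pow, eτ] at h2
    simp only [map_mul, map_sub, map_one, τ_J] at h2
    push_cast
    have h3 : ((p : L) ^ 2 + q ^ 2) ^ 2 = 2 * (y * D.τ y) := by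
      have e1 : (p : L) ^ 2 + q ^ 2 = (p + q * D.J) * (p - q * D.J) := by
        linear_combination (q ^ 2 : L) * hJ
      rw [e1, mul_pow, h, h2]
      linear_combination -(y * D.τ y) * hJ
    rw [h3]; ring
  obtain ⟨P, hP⟩ := hP.exists_int_of_ratCast
  obtain ⟨Q, hQ⟩ := hQ.exists_int_of_ratCast
  obtain ⟨n, hn⟩ := hn.exists_int_of_ratCast
  obtain ⟨N, hN⟩ := hN.exists_int_of_ratCast
  rw [hn] at hN
  have e1 : n ^ 2 = 2 * N := by
    have : (n : ℚ) ^ 2 = 2 * N := by rw [← hN]; ring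
    exact_mod_cast this
  have e2 : P ^ 2 + Q ^ 2 = 4 * n := by
    have : (P : ℚ) ^ 2 + Q ^ 2 = 4 * n := by rw [← hP, ← hQ, ← hn]; ring
    exact_mod_cast this
  obtain ⟨⟨P, rfl⟩, ⟨Q, rfl⟩⟩ := Int.even_of_sq_add_sq e2
  have hpe : Even (n ^ 2) := ⟨N, by rw [e1]; ring⟩
  have hne : Even n := (Int.even_pow.mp hpe).1
  have e3 : P ^ 2 + Q ^ 2 = n := by linarith
  have hPQ : Even (P + Q) := by
    rw [← e3] at hne
    simpa [Int.even_add, Int.even_pow] using hne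
  obtain ⟨r, hr⟩ := hPQ
  have hp' : p = P := by push_cast at hP; linarith
  have hq' : q = Q := by push_cast at hQ; linarith
  have hr' : (P : L) + Q = r + r := by exact_mod_cast congrArg (Int.cast : ℤ → L) hr
  refine ⟨(r - Q : ℤ) + r * D.J, (IsIntegral.intCast _).add ((IsIntegral.intCast _).mul iJ), ?_⟩
  rw [hp', hq']
  push_cast
  linear_combination hr' + r * hJ

/-- The integral element `(1 + √-m) / 2`. -/
noncomputable def w : L := (1 + D.J * D.θ ^ 2) / 2

theorem two_mul_w : 2 * D.w = 1 + D.J * D.θ ^ 2 := by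
  unfold w; ring

theorem ρ_w : D.ρ D.w = 1 - D.w := by
  simp only [w, map_div₀, map_add, map_mul, map_pow, map_one, map_ofNat, ρ_J, ρ_θ]
  linear_combination (D.J * D.θ ^ 2 / 2) * D.J_sq

theorem isIntegral_w {k : ℕ} (hk : m + 1 = 4 * k) : IsIntegral ℤ D.w := by
  have hk' : (m : L) + 1 = 4 * k := by exact_mod_cast congrArg (Nat.cast : ℕ → L) hk
  refine IsIntegral.of_aeval_monic (p := Polynomial.X ^ 2 - Polynomial.X) ?_ ?_ ?_
  · monicity!
  · have : (Polynomial.X ^ 2 - Polynomial.X : Polynomial ℤ).natDegree = 2 := by compute_degree!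
    rw [this]; norm_num
  · have : Polynomial.aeval D.w (Polynomial.X ^ 2 - Polynomial.X : Polynomial ℤ) = -(k : L) := by
      simp only [map_sub, map_pow, Polynomial.aeval_X, w]
      linear_combination D.θ ^ 4 / 4 * D.J_sq - D.θ_pow / 4 - hk' / 4
    rw [this]
    exact (IsIntegral.natCast k).neg

/-- The ideal `(1 - i)` is radical in the ring of integers of the subfield fixed by `ρ ^ 2`. -/
theorem one_sub_J_dvd_of_ρ_ρ {k : ℕ} (hk : m + 1 = 4 * k) {t y : L} (ht : IsIntegral ℤ t)
    (hy : IsIntegral ℤ y) (hρ : D.ρ (D.ρ t) = t) (h : t ^ 2 = (1 - D.J) * y) :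
    ∃ z, IsIntegral ℤ z ∧ t = (1 - D.J) * z := by
  have hk' : (m : L) + 1 = 4 * k := by exact_mod_cast congrArg (Nat.cast : ℕ → L) hk
  have hJ := D.J_sq
  have iJ := D.isIntegral_J
  have iw := D.isIntegral_w hk
  have i1 : IsIntegral ℤ (1 : L) := isIntegral_one
  have it := map_isIntegral_int D.ρ ht
  have iy := map_isIntegral_int D.ρ hy
  have h' : (D.ρ t) ^ 2 = (1 - D.J) * D.ρ y := by
    simpa using congrArg D.ρ h
  obtain ⟨z₁, iz₁, hz₁⟩ := D.one_sub_J_dvd_of_ρ (T := t + D.ρ t)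
    (y := y + D.ρ y + (1 + D.J) * (t * D.ρ t)) (ht.add it)
    ((hy.add iy).add ((i1.add iJ).mul (ht.mul it)))
    (by rw [map_add, hρ]; ring) (by linear_combination h + h' + t * D.ρ t * hJ)
  obtain ⟨z₂, iz₂, hz₂⟩ := D.one_sub_J_dvd_of_ρ (T := t * D.w + D.ρ t * (1 - D.w))
    (y := y * D.w ^ 2 + D.ρ y * (1 - D.w) ^ 2 + (1 + D.J) * (t * D.w * (D.ρ t * (1 - D.w))))
    ((ht.mul iw).add (it.mul (i1.sub iw)))
    (((hy.mul (iw.pow 2)).add (iy.mul ((i1.sub iw).pow 2))).add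
      ((i1.add iJ).mul ((ht.mul iw).mul (it.mul (i1.sub iw)))))
    (by simp only [map_add, map_mul, map_sub, map_one, hρ, D.ρ_w]; ring)
    (by linear_combination D.w ^ 2 * h + (1 - D.w) ^ 2 * h' +
          t * D.w * (D.ρ t * (1 - D.w)) * hJ)
  refine ⟨2 * k * (1 + D.J) * t + D.J * D.θ ^ 2 * (z₂ - (1 - D.w) * z₁), ?_, ?_⟩
  · refine IsIntegral.add ?_ ?_
    · exact ((((IsIntegral.natCast 2).mul (IsIntegral.natCast k))).mul (i1.add iJ)).mul ht
    · exact (iJ.mul (D.isIntegral_θ.pow 2)).mul (iz₂.sub ((i1.sub iw).mul iz₁))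
  · have e : t * (D.J * D.θ ^ 2) = (1 - D.J) * (z₂ - (1 - D.w) * z₁) := by
      linear_combination hz₂ - (1 - D.w) * hz₁ - t * D.two_mul_w
    linear_combination D.J * D.θ ^ 2 * e + (2 * k * t - t * D.θ ^ 4) * hJ + t * D.θ_pow + t * hk'

theorem one_sub_J_dvd_of_sq_sub {k : ℕ} (hk : m + 1 = 4 * k) {a b X : L} (ha : IsIntegral ℤ a)
    (hb : IsIntegral ℤ b) (hX : IsIntegral ℤ X) (hρa : D.ρ (D.ρ a) = a) (hρb : D.ρ (D.ρ b) = b)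
    (h : a ^ 2 - b ^ 2 * D.θ ^ 2 = 2 * X) :
    ∃ a' b', IsIntegral ℤ a' ∧ IsIntegral ℤ b' ∧ D.ρ (D.ρ a') = a' ∧ D.ρ (D.ρ b') = b' ∧
      a = (1 - D.J) * a' ∧ b = (1 - D.J) * b' := by
  have hJ := D.J_sq
  have iJ := D.isIntegral_J
  have iw := D.isIntegral_w hk
  have i1 : IsIntegral ℤ (1 : L) := isIntegral_one
  have hθ : D.θ ^ 2 = D.J - 2 * D.J * D.w := by
    linear_combination D.θ ^ 2 * hJ + D.J * D.two_mul_w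
  obtain ⟨t, it, ht⟩ := D.one_sub_J_dvd_of_ρ_ρ hk (t := a - b)
    (y := (1 + D.J) * (X - a * b - D.J * D.w * b ^ 2) + D.J * b ^ 2) (ha.sub hb)
    (((i1.add iJ).mul ((hX.sub (ha.mul hb)).sub ((iJ.mul iw).mul (hb.pow 2)))).add
      (iJ.mul (hb.pow 2))) (by rw [map_sub, map_sub, hρa, hρb])
    (by
      rw [hθ] at h
      linear_combination h + (X - a * b - D.J * D.w * b ^ 2 + b ^ 2) * hJ)
  obtain ⟨b', ib', hb'⟩ := D.one_sub_J_dvd_of_ρ_ρ hk (t := b)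
    (y := D.J * (X - D.J * D.w * b ^ 2 - (1 - D.J) * (b * t) + D.J * t ^ 2)) hb
    (iJ.mul (((hX.sub ((iJ.mul iw).mul (hb.pow 2))).sub ((i1.sub iJ).mul (hb.mul it))).add
      (iJ.mul (it.pow 2)))) hρb
    (by
      have ea : a = b + (1 - D.J) * t := by linear_combination ht
      rw [hθ, ea] at h
      refine mul_left_cancel₀ D.one_sub_J_ne_zero ?_
      have e : (1 - D.J) * b ^ 2 =
          2 * (X - D.J * D.w * b ^ 2 - (1 - D.J) * (b * t) + D.J * t ^ 2) := by
        linear_combination h - t ^ 2 * hJ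
      linear_combination e - (D.J - 2) *
        (X - D.J * D.w * b ^ 2 - (1 - D.J) * (b * t) + D.J * t ^ 2) * hJ)
  have ha' : a = (1 - D.J) * (b' + t) := by linear_combination ht + hb'
  have key : ∀ x x' : L, D.ρ (D.ρ x) = x → x = (1 - D.J) * x' → D.ρ (D.ρ x') = x' := by
    intro x x' h1 h2
    refine mul_left_cancel₀ D.one_sub_J_ne_zero ?_
    rw [h2] at h1
    simpa using h1
  exact ⟨b' + t, b', ib'.add it, ib', key _ _ hρa ha', key _ _ hρb hb', ha', hb'⟩

theorem two_dvd_of_sq_sub {k : ℕ} (hk : m + 1 = 4 * k) {a b X : L} (ha : IsIntegral ℤ a)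
    (hb : IsIntegral ℤ b) (hX : IsIntegral ℤ X) (hρa : D.ρ (D.ρ a) = a) (hρb : D.ρ (D.ρ b) = b)
    (h : a ^ 2 - b ^ 2 * D.θ ^ 2 = 4 * X) : ∃ c, IsIntegral ℤ c ∧ b = 2 * c := by
  have hJ := D.J_sq
  have iJ := D.isIntegral_J
  obtain ⟨a₁, b₁, ia₁, ib₁, ha₁, hb₁, rfl, rfl⟩ := D.one_sub_J_dvd_of_sq_sub hk ha hb
    ((IsIntegral.natCast 2).mul hX) hρa hρb (by rw [h]; push_cast; ring)
  have h1 : a₁ ^ 2 - b₁ ^ 2 * D.θ ^ 2 = 2 * (D.J * X) := by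
    linear_combination D.J / 2 * h +
      ((a₁ ^ 2 - b₁ ^ 2 * D.θ ^ 2) * (2 - D.J) / 2) * hJ
  obtain ⟨a₂, b₂, -, ib₂, -, -, -, rfl⟩ := D.one_sub_J_dvd_of_sq_sub hk ia₁ ib₁
    (iJ.mul hX) ha₁ hb₁ h1
  exact ⟨-(D.J * b₂), (iJ.mul ib₂).neg, by linear_combination b₂ * hJ⟩

/-- For integral `α`, the element `2 * θ` divides `α - ρ (ρ α)`. -/
theorem exists_sub_eq_two_mul_θ {k : ℕ} (hk : m + 1 = 4 * k) (hm : Squarefree m) {α : L}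
    (hα : IsIntegral ℤ α) : ∃ B, IsIntegral ℤ B ∧ α - D.ρ (D.ρ α) = 2 * D.θ * B := by
  have hk' : (m : L) + 1 = 4 * k := by exact_mod_cast congrArg (Nat.cast : ℕ → L) hk
  have hJ := D.J_sq
  have iJ := D.isIntegral_J
  have iθ := D.isIntegral_θ
  have hθ0 := D.θ_ne_zero hm.ne_zero
  set y := α - D.ρ (D.ρ α) with hy
  have iy : IsIntegral ℤ y := hα.sub (map_isIntegral_int _ (map_isIntegral_int _ hα))
  have hρy : D.ρ (D.ρ y) = -y := by rw [hy, map_sub, map_sub, D.ρ_ρ_ρ_ρ]; ring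
  obtain ⟨a₀, a₁, a₂, a₃, a₄, a₅, a₆, a₇, hx⟩ := D.coords y
  have iρ := map_isIntegral_int D.ρ iy
  have e₁ : y - D.J * D.ρ y = 2 * (a₂ + a₃ * D.J) * D.θ := by
    have e : y - D.J * D.ρ y - D.ρ (D.ρ y) + D.J * D.ρ (D.ρ (D.ρ y)) =
        4 * (a₂ + a₃ * D.J) * D.θ := by
      rw [hx]
      simp only [map_add, map_mul, map_pow, map_ratCast, ρ_J, ρ_θ]
      linear_combination ((a₂ + a₃ * D.J) * D.θ * (D.J ^ 2 - 3)
        - (a₄ + a₅ * D.J) * D.θ ^ 2 * (D.J ^ 2 - 1) * (1 - D.J ^ 3)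
        - (a₆ + a₇ * D.J) * D.θ ^ 3 * (D.J ^ 2 - 1) * (1 - D.J ^ 6)) * hJ
    rw [hρy, map_neg] at e
    linear_combination e / 2
  have e₃ : y + D.J * D.ρ y = 2 * (a₆ + a₇ * D.J) * D.θ ^ 3 := by
    have e : y + D.J * D.ρ y - D.ρ (D.ρ y) - D.J * D.ρ (D.ρ (D.ρ y)) =
        4 * (a₆ + a₇ * D.J) * D.θ ^ 3 := by
      rw [hx]
      simp only [map_add, map_mul, map_pow, map_ratCast, ρ_J, ρ_θ]
      linear_combination (-(a₂ + a₃ * D.J) * D.θ * (D.J ^ 2 - 1)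
        - (a₄ + a₅ * D.J) * D.θ ^ 2 * (D.J ^ 2 - 1) * (1 + D.J ^ 3)
        - (a₆ + a₇ * D.J) * D.θ ^ 3 *
          (D.J ^ 8 - D.J ^ 6 + 2 * D.J ^ 4 - 3 * D.J ^ 2 + 3)) * hJ
    rw [hρy, map_neg] at e
    linear_combination e / 2
  have rat : ∀ (p q : ℚ) (n : ℕ), (n = 1 ∨ n = 3) →
      IsIntegral ℤ (2 * (p + q * D.J) * D.θ ^ n) → (∃ z : ℤ, 4 * p = z) ∧ ∃ z : ℤ, 4 * q = z := by
    intro p q n hn h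
    have hτ := map_isIntegral_int D.τ h
    have eτ : D.τ (2 * (p + q * D.J) * D.θ ^ n) = 2 * (p - q * D.J) * D.θ ^ n := by
      simp only [map_add, map_mul, map_pow, map_ratCast, map_ofNat, τ_J, τ_θ]; ring
    have key : ∀ r : ℚ, IsIntegral ℤ (r * D.θ ^ n) → ∃ z : ℤ, r = z := by
      intro r hr
      have h3 : IsIntegral ℤ (r * D.θ ^ 3) := by
        rcases hn with rfl | rfl
        · refine IsIntegral.of_eq (hr.mul (iθ.pow 2)) ?_
          ring
        · exact hr
      have h4 : IsIntegral ℤ ((r ^ 4 * m ^ 3 : ℚ) : L) := by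
        refine IsIntegral.of_eq (h3.pow 4) ?_
        push_cast
        rw [← D.θ_pow]; ring
      obtain ⟨z, hz⟩ := h4.exists_int_of_ratCast
      exact Rat.exists_int_of_pow_four_mul hm hz
    constructor
    · apply key
      refine IsIntegral.of_eq (h.add hτ) ?_
      rw [eτ]; push_cast; ring
    · apply key
      refine IsIntegral.of_eq ((iJ.mul (h.sub hτ)).neg) ?_
      rw [eτ]; push_cast
      linear_combination (4 * q * D.θ ^ n) * hJ
  obtain ⟨⟨A₂, h₂⟩, ⟨A₃, h₃⟩⟩ := rat a₂ a₃ 1 (.inl rfl) (by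
    rw [pow_one, ← e₁]; exact iy.sub (iJ.mul iρ))
  obtain ⟨⟨A₆, h₆⟩, ⟨A₇, h₇⟩⟩ := rat a₆ a₇ 3 (.inr rfl) (by
    rw [← e₃]; exact iy.add (iJ.mul iρ))
  have hB0 : y = D.θ * ((a₂ + a₃ * D.J) + (a₆ + a₇ * D.J) * D.θ ^ 2) := by
    linear_combination (e₁ + e₃) / 2
  set b : L := (a₂ + a₃ * D.J) + (a₆ + a₇ * D.J) * D.θ ^ 2 with hb
  have i4 : IsIntegral ℤ (4 * b) := by
    have : 4 * b = (A₂ + A₃ * D.J) + (A₆ + A₇ * D.J) * D.θ ^ 2 := by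
      have c : ∀ (q : ℚ) (z : ℤ), 4 * q = z → 4 * (q : L) = z := fun q z h => by
        exact_mod_cast congrArg (Rat.cast : ℚ → L) h
      rw [← c _ _ h₂, ← c _ _ h₃, ← c _ _ h₆, ← c _ _ h₇, hb]; ring
    rw [this]
    exact ((IsIntegral.intCast _).add ((IsIntegral.intCast _).mul iJ)).add
      (((IsIntegral.intCast _).add ((IsIntegral.intCast _).mul iJ)).mul (iθ.pow 2))
  have hρb : D.ρ (D.ρ b) = b := by
    rw [hB0] at hρy
    refine mul_left_cancel₀ hθ0 ?_
    simp only [map_mul, ρ_θ, ρ_J] at hρy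
    linear_combination D.θ * D.ρ (D.ρ b) * hJ - hρy
  have imb : IsIntegral ℤ (m * b) := by
    have : m * b = D.θ ^ 3 * y := by rw [hB0, ← D.θ_pow]; ring
    rw [this]; exact (iθ.pow 3).mul iy
  have iρρ := map_isIntegral_int D.ρ (map_isIntegral_int D.ρ hα)
  obtain ⟨c, ic, hc⟩ := D.two_dvd_of_sq_sub hk (a := m * (α + D.ρ (D.ρ α))) (b := m * b)
    (X := m ^ 2 * (α * D.ρ (D.ρ α))) ((IsIntegral.natCast m).mul (hα.add iρρ)) imb
    (((IsIntegral.natCast m).pow 2).mul (hα.mul iρρ))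
    (by simp only [map_mul, map_add, map_natCast, D.ρ_ρ_ρ_ρ]; ring)
    (by simp only [map_mul, map_natCast, hρb])
    (by
      have : (m * b) ^ 2 * D.θ ^ 2 = m ^ 2 * y ^ 2 := by rw [hB0]; ring
      rw [this, hy]; ring)
  have iB8 : IsIntegral ℤ (4 * (b / 2)) := by
    have : 4 * (b / 2) = k * (2 * (4 * b)) - 4 * c := by
      linear_combination (2 * b) * hk' - 2 * hc
    rw [this]
    exact ((IsIntegral.natCast k).mul ((IsIntegral.natCast 2).mul i4)).sub
      ((IsIntegral.natCast 4).mul ic)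
  refine ⟨b / 2, ?_, by rw [hB0]; ring⟩
  have : b / 2 = k * (4 * (b / 2)) - c := by
    linear_combination (b / 2) * hk' - hc / 2
  rw [this]
  exact ((IsIntegral.natCast k).mul iB8).sub ic

theorem exists_inv_of_dvd {k : ℕ} (hk : m + 1 = 4 * k) {u z z' : L} (hz : IsIntegral ℤ z)
    (hz' : IsIntegral ℤ z') (h : 2 * D.J = u * z) (h' : D.J * D.θ ^ 2 = u * z') :
    ∃ v, IsIntegral ℤ v ∧ u * v = 1 := by
  have hk' : (m : L) + 1 = 4 * k := by exact_mod_cast congrArg (Nat.cast : ℕ → L) hk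
  have iJ := D.isIntegral_J
  refine ⟨D.J * D.θ ^ 2 * z' - 2 * k * D.J * z, ?_, ?_⟩
  · exact ((iJ.mul (D.isIntegral_θ.pow 2)).mul hz').sub
      ((((IsIntegral.natCast 2).mul (IsIntegral.natCast k)).mul iJ).mul hz)
  · linear_combination 2 * k * D.J * h - D.J * D.θ ^ 2 * h' + (D.θ ^ 4 - 4 * k) * D.J_sq
      - D.θ_pow - hk'

theorem exists_int_coords {k : ℕ} (hk : m + 1 = 4 * k) (hm : Squarefree m) {x : L}
    (hx : IsIntegral ℤ x) (hρ : D.ρ (D.ρ x) = x) (hτ : D.τ x = x) :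
    ∃ a b : ℤ, x = a + b * D.θ ^ 2 := by
  obtain ⟨p, q, rfl⟩ := D.exists_coords_of_ρ_ρ_τ hρ hτ
  have hJ := D.J_sq
  have iρ := map_isIntegral_int D.ρ hx
  have eρ : D.ρ (p + q * D.θ ^ 2) = p - q * D.θ ^ 2 := by
    simp only [map_add, map_mul, map_pow, map_ratCast, ρ_θ]
    linear_combination q * D.θ ^ 2 * hJ
  have hP : IsIntegral ℤ ((2 * p : ℚ) : L) := by
    refine IsIntegral.of_eq (hx.add iρ) ?_
    rw [eρ]; push_cast; ring
  have hn : IsIntegral ℤ ((p ^ 2 - m * q ^ 2 : ℚ) : L) := by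
    refine IsIntegral.of_eq (hx.mul iρ) ?_
    rw [eρ]; push_cast; rw [← D.θ_pow]; ring
  obtain ⟨P, hP⟩ := hP.exists_int_of_ratCast
  obtain ⟨n, hn⟩ := hn.exists_int_of_ratCast
  have h4 : (2 * q) ^ 4 * (m : ℚ) ^ 3 = ((m * (P ^ 2 - 4 * n) ^ 2 : ℤ) : ℚ) := by
    push_cast; rw [← hP, ← hn]; ring
  obtain ⟨Q, hQ⟩ := Rat.exists_int_of_pow_four_mul hm h4
  have e : P ^ 2 + Q ^ 2 = 4 * (n + k * Q ^ 2) := by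
    have hk' : (m : ℚ) + 1 = 4 * k := by exact_mod_cast congrArg (Nat.cast : ℕ → ℚ) hk
    have : (P : ℚ) ^ 2 + Q ^ 2 = 4 * (n + k * Q ^ 2) := by
      rw [← hP, ← hQ, ← hn]; linear_combination 4 * q ^ 2 * hk'
    exact_mod_cast this
  obtain ⟨⟨P, rfl⟩, ⟨Q, rfl⟩⟩ := Int.even_of_sq_add_sq e
  refine ⟨P, Q, ?_⟩
  have hp' : p = P := by push_cast at hP; linarith
  have hq' : q = Q := by push_cast at hQ; linarith
  rw [hp', hq']; push_cast; ring

theorem ρ_int_coords (a b : ℤ) : D.ρ (a + b * D.θ ^ 2) = a - b * D.θ ^ 2 := by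
  simp only [map_add, map_mul, map_pow, map_intCast, ρ_θ]
  linear_combination b * D.θ ^ 2 * D.J_sq

/-- Units of the real quadratic subfield have relative norm `1`. -/
theorem mul_ρ_eq_one {k : ℕ} (hk : m + 1 = 4 * k) (hm : Squarefree m) {x z : L}
    (hx : IsIntegral ℤ x) (hz : IsIntegral ℤ z) (hxz : x * z = 1) (hρ : D.ρ (D.ρ x) = x)
    (hτ : D.τ x = x) : x * D.ρ x = 1 := by
  obtain ⟨a, b, rfl⟩ := D.exists_int_coords hk hm hx hρ hτ
  have hN : (a + b * D.θ ^ 2) * D.ρ (a + b * D.θ ^ 2) = ((a ^ 2 - m * b ^ 2 : ℤ) : L) := by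
    rw [D.ρ_int_coords]; push_cast; rw [← D.θ_pow]; ring
  set n : ℤ := a ^ 2 - m * b ^ 2 with hn
  have hzz : (n : L) * (z * D.ρ z) = 1 := by
    have h2 := congrArg D.ρ hxz
    rw [map_mul, map_one] at h2
    rw [← hN]
    linear_combination D.ρ (a + b * D.θ ^ 2) * D.ρ z * hxz + h2
  have hn0 : (n : L) ≠ 0 := left_ne_zero_of_mul_eq_one hzz
  have hi : IsIntegral ℤ (((n : ℚ)⁻¹ : ℚ) : L) := by
    refine IsIntegral.of_eq (hz.mul (map_isIntegral_int D.ρ hz)) ?_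
    push_cast
    exact (eq_inv_of_mul_eq_one_right hzz).symm
  obtain ⟨c, hc⟩ := hi.exists_int_of_ratCast
  have hnc : n * c = 1 := by
    have hn0' : (n : ℚ) ≠ 0 := by
      intro h; apply hn0; exact_mod_cast congrArg (Rat.cast : ℚ → L) h
    have : (n : ℚ) * c = 1 := by rw [← hc]; exact mul_inv_cancel₀ hn0'
    exact_mod_cast this
  rw [hN]
  rcases Int.eq_one_or_neg_one_of_mul_eq_one hnc with h | h
  · rw [h]; norm_num
  · exfalso
    have hk' : (m : ℤ) = 4 * k - 1 := by omega
    have e : a ^ 2 + b ^ 2 = 4 * (k * b ^ 2) - 1 := by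
      rw [h, hk'] at hn; linarith
    rcases Int.even_or_odd' a with ⟨a', rfl | rfl⟩ <;>
      rcases Int.even_or_odd' b with ⟨b', rfl | rfl⟩ <;> ring_nf at e <;> omega

/-- There is no integral `α` such that `α - g α` divides `x - g x` for all integral `x` and all
endomorphisms `g`. -/
theorem not_generated (D : OcticData L m) {k : ℕ} (hk : m + 1 = 4 * k) (hm : Squarefree m) {α : L}
    (hα : IsIntegral ℤ α)
    (hgen : ∀ (g : L →+* L) (x : L), IsIntegral ℤ x →
      ∃ z, IsIntegral ℤ z ∧ x - g x = (α - g α) * z) : False := by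
  have hJ := D.J_sq
  have iθ := D.isIntegral_θ
  have hθ0 := D.θ_ne_zero hm.ne_zero
  obtain ⟨B, iB, hB⟩ := D.exists_sub_eq_two_mul_θ hk hm hα
  obtain ⟨C, iC, hC⟩ := hgen (D.ρ.comp D.ρ) D.θ iθ
  simp only [RingHom.comp_apply, ρ_θ, map_mul, ρ_J] at hC
  have hBC : B * C = 1 := by
    refine mul_left_cancel₀ (mul_ne_zero two_ne_zero hθ0) ?_
    rw [hB] at hC
    linear_combination -hC - D.θ * hJ
  have hρB : D.ρ (D.ρ B) = B := by
    refine mul_left_cancel₀ (mul_ne_zero two_ne_zero hθ0) ?_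
    have h := congrArg (fun x => D.ρ (D.ρ x)) hB
    simp only [map_sub, map_mul, map_ofNat, ρ_θ, ρ_J, D.ρ_ρ_ρ_ρ] at h
    linear_combination 2 * D.θ * D.ρ (D.ρ B) * hJ + h + hB
  have iw := D.isIntegral_w hk
  set u := α - D.τ α with hu
  set v := α - D.ρ (D.ρ (D.τ α)) with hv
  have unit_of : ∀ g : L →+* L, g D.J = -D.J → g (D.θ ^ 2) = D.θ ^ 2 →
      ∃ u', IsIntegral ℤ u' ∧ (α - g α) * u' = 1 := by
    intro g h1 h2
    obtain ⟨z, iz, hz⟩ := hgen g D.J D.isIntegral_J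
    obtain ⟨z', iz', hz'⟩ := hgen g D.w iw
    refine D.exists_inv_of_dvd hk iz iz' ?_ ?_
    · rw [← hz, h1]; ring
    · rw [← hz', w, map_div₀, map_add, map_mul, h1, h2, map_one, map_ofNat]; ring
  obtain ⟨u', iu', hu'⟩ := unit_of D.τ D.τ_J (by simp)
  obtain ⟨v', iv', hv'⟩ := unit_of (D.ρ.comp (D.ρ.comp D.τ)) (by simp) (by
    simp only [RingHom.comp_apply, map_pow, τ_θ, ρ_θ, map_mul, ρ_J]
    linear_combination D.θ ^ 2 * (D.J ^ 2 - 1) * hJ)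
  rw [← hu] at hu'
  simp only [RingHom.comp_apply] at hv'
  rw [← hv] at hv'
  have iτ := fun {x : L} (h : IsIntegral ℤ x) => map_isIntegral_int D.τ h
  have iρ := fun {x : L} (h : IsIntegral ℤ x) => map_isIntegral_int D.ρ h
  have iu : IsIntegral ℤ u := hα.sub (iτ hα)
  have iv : IsIntegral ℤ v := hα.sub (iρ (iρ (iτ hα)))
  have prod_unit : ∀ {x y : L} (g : L →+* L), x * y = 1 → (x * g x) * (y * g y) = 1 := by
    intro x y g h
    have h2 := congrArg g h
    rw [map_mul, map_one] at h2
    linear_combination g x * g y * h + h2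
  have ηρ : D.ρ (D.ρ (B * D.τ B)) = B * D.τ B := by
    rw [map_mul, map_mul, D.ρ_ρ_τ, hρB]
  have ητ : D.τ (B * D.τ B) = B * D.τ B := by rw [map_mul, D.τ_τ]; ring
  have N₁ρ : D.ρ (D.ρ (u * D.ρ (D.ρ u))) = u * D.ρ (D.ρ u) := by
    rw [map_mul, map_mul, D.ρ_ρ_ρ_ρ]; ring
  have N₁τ : D.τ (u * D.ρ (D.ρ u)) = u * D.ρ (D.ρ u) := by
    rw [map_mul, ← D.ρ_ρ_τ, hu, map_sub, D.τ_τ]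
    simp only [map_sub]; ring
  have hη := D.mul_ρ_eq_one hk hm (iB.mul (iτ iB)) (iC.mul (iτ iC)) (prod_unit D.τ hBC) ηρ ητ
  have hN₁ := D.mul_ρ_eq_one hk hm (iu.mul (iρ (iρ iu))) (iu'.mul (iρ (iρ iu')))
    (prod_unit (D.ρ.comp D.ρ) hu') N₁ρ N₁τ
  have hN₂ := D.mul_ρ_eq_one hk hm (iv.mul (iρ (iρ iv))) (iv'.mul (iρ (iρ iv')))
    (prod_unit (D.ρ.comp D.ρ) hv') (by rw [map_mul, map_mul, D.ρ_ρ_ρ_ρ]; ring)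
    (by
      rw [map_mul, ← D.ρ_ρ_τ, hv, map_sub, ← D.ρ_ρ_τ, D.τ_τ]
      simp only [map_sub, D.ρ_ρ_ρ_ρ]; ring)
  have iκ := (iu.mul (iρ (iρ iu))).mul (iρ (iB.mul (iτ iB)))
  have hdiff : u * D.ρ (D.ρ u) - v * D.ρ (D.ρ v) = 4 * (B * D.τ B) * D.θ ^ 2 := by
    have hBτ := congrArg D.τ hB
    simp only [map_sub, map_mul, map_ofNat, τ_θ] at hBτ
    simp only [hu, hv, map_sub, D.ρ_ρ_ρ_ρ, D.ρ_ρ_τ]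
    have h1 : (α - D.ρ (D.ρ α)) * (D.τ α - D.τ (D.ρ (D.ρ α))) =
      4 * (B * D.τ B) * D.θ ^ 2 := by rw [hB, hBτ]; ring
    linear_combination h1
  have hdiff' := congrArg D.ρ hdiff
  set N₁ := u * D.ρ (D.ρ u)
  set N₂ := v * D.ρ (D.ρ v)
  set η := B * D.τ B with hηdef
  simp only [map_sub, map_mul D.ρ (4 * η), map_mul D.ρ 4, map_ofNat, map_pow, ρ_θ] at hdiff'
  have e₁ : N₂ = N₁ - 4 * η * D.θ ^ 2 := by linear_combination -hdiff
  have e₂ : D.ρ N₂ = D.ρ N₁ + 4 * D.ρ η * D.θ ^ 2 := by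
    linear_combination -hdiff' - 4 * D.ρ η * D.θ ^ 2 * hJ
  rw [e₂, e₁] at hN₂
  have hκ : N₁ * D.ρ η - D.ρ N₁ * η = 4 * D.θ ^ 2 := by
    refine mul_left_cancel₀ (mul_ne_zero (by norm_num : (4 : L) ≠ 0) (pow_ne_zero 2 hθ0)) ?_
    linear_combination hN₂ - hN₁ + 16 * D.θ ^ 4 * hη
  have hη0 : η ≠ 0 := left_ne_zero_of_mul_eq_one hη
  have τρη : D.τ (D.ρ η) = D.ρ η := by
    have h := congrArg D.τ hη
    rw [map_mul, ητ, map_one] at h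
    exact mul_left_cancel₀ hη0 (h.trans hη.symm)
  obtain ⟨a, b, hab⟩ := D.exists_int_coords hk hm iκ
    (by rw [map_mul, map_mul, ηρ, N₁ρ]) (by rw [map_mul, N₁τ, τρη])
  have hab' : D.ρ N₁ * η = a - b * D.θ ^ 2 := by
    rw [← D.ρ_int_coords, ← hab, map_mul D.ρ N₁, ηρ]
  have hs0 : D.θ ^ 2 ≠ 0 := pow_ne_zero 2 hθ0
  have hb : b = 2 := by
    have h : (b : L) = (2 : ℤ) := by
      refine mul_left_cancel₀ (mul_ne_zero two_ne_zero hs0) ?_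
      push_cast
      linear_combination hκ - hab + hab'
    exact_mod_cast h
  have ha : a ^ 2 - m * b ^ 2 = 1 := by
    have h : (a : L) ^ 2 - m * b ^ 2 = 1 := by
      have h2 : (a + b * D.θ ^ 2) * (a - b * D.θ ^ 2) = 1 := by
        rw [← hab, ← hab']
        linear_combination η * D.ρ η * hN₁ + hη
      rw [← D.θ_pow, ← h2]; ring
    exact_mod_cast h
  have hk' : (m : ℤ) = 4 * k - 1 := by omega
  rw [hb, hk'] at ha
  obtain ⟨c, rfl | rfl⟩ := Int.even_or_odd' a
  · ring_nf at ha; omega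
  · obtain ⟨d, hd⟩ := Int.even_mul_succ_self c
    have : 4 * (d + d) = 16 * k - 4 := by rw [← hd]; linarith
    omega

end OcticData

section Kfield

open Polynomial

theorem theta_pow_four (m : ℕ) : theta m ^ 4 = m := by
  rw [theta, ← Complex.ofReal_pow, ← Real.rpow_natCast, ← Real.rpow_mul (Nat.cast_nonneg m)]
  norm_num

/-- The imaginary unit as an element of `Kfield m`. -/
noncomputable def Kfield.I (m : ℕ) : Kfield m :=
  ⟨Complex.I, IntermediateField.subset_adjoin _ _ (by simp)⟩

/-- The fourth root of `m` as an element of `Kfield m`. -/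
noncomputable def Kfield.root (m : ℕ) : Kfield m :=
  ⟨theta m, IntermediateField.subset_adjoin _ _ (by simp)⟩

theorem Kfield.I_sq (m : ℕ) : Kfield.I m ^ 2 = -1 :=
  Subtype.ext Complex.I_sq

theorem Kfield.root_pow (m : ℕ) : Kfield.root m ^ 4 = m :=
  Subtype.ext (theta_pow_four m)

theorem Kfield.isIntegral_I : IsIntegral ℚ Complex.I :=
  IsIntegral.of_pow (n := 2) (by norm_num) (by rw [Complex.I_sq]; exact isIntegral_one.neg)

theorem Kfield.isIntegral_theta (m : ℕ) : IsIntegral ℚ (theta m) := by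
  refine IsIntegral.of_pow (n := 4) (by norm_num) ?_
  rw [theta_pow_four]
  simpa using isIntegral_algebraMap (R := ℚ) (A := ℂ) (x := (m : ℚ))

theorem Kfield.induction {m : ℕ} {P : Kfield m → Prop} (hI : P (Kfield.I m))
    (hroot : P (Kfield.root m)) (hrat : ∀ q : ℚ, P q) (hadd : ∀ x y, P x → P y → P (x + y))
    (hmul : ∀ x y, P x → P y → P (x * y)) (x : Kfield m) : P x := by
  have key : ∀ z ∈ Algebra.adjoin ℚ {Complex.I, theta m}, ∃ y : Kfield m, P y ∧ (y : ℂ) = z := by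
    intro z hz
    induction hz using Algebra.adjoin_induction with
    | mem z hz =>
      rcases hz with rfl | rfl
      · exact ⟨_, hI, rfl⟩
      · exact ⟨_, hroot, rfl⟩
    | algebraMap q => exact ⟨q, hrat q, by simp⟩
    | add z w _ _ hz hw =>
      obtain ⟨y, hy, rfl⟩ := hz
      obtain ⟨y', hy', rfl⟩ := hw
      exact ⟨y + y', hadd _ _ hy hy', rfl⟩
    | mul z w _ _ hz hw =>
      obtain ⟨y, hy, rfl⟩ := hz
      obtain ⟨y', hy', rfl⟩ := hw
      exact ⟨y * y', hmul _ _ hy hy', rfl⟩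
  have hx : (x : ℂ) ∈ Algebra.adjoin ℚ {Complex.I, theta m} := by
    rw [← IntermediateField.adjoin_toSubalgebra_of_isAlgebraic]
    · exact x.2
    · rintro z (rfl | rfl)
      · exact (Kfield.isIntegral_I).isAlgebraic
      · exact (Kfield.isIntegral_theta m).isAlgebraic
  obtain ⟨y, hy, hyx⟩ := key _ hx
  rwa [← Subtype.ext hyx]

theorem Kfield.exists_coords {m : ℕ} {J θ : Kfield m} (hJ : J ^ 2 = -1) (hθ : θ = Kfield.root m)
    (hI : J = Kfield.I m ∨ J = -Kfield.I m) (x : Kfield m) :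
    ∃ a₀ a₁ a₂ a₃ a₄ a₅ a₆ a₇ : ℚ,
      x = (a₀ + a₁ * J) + (a₂ + a₃ * J) * θ + (a₄ + a₅ * J) * θ ^ 2 + (a₆ + a₇ * J) * θ ^ 3 := by
  have h4 : θ ^ 4 = m := by rw [hθ, Kfield.root_pow]
  induction x using Kfield.induction with
  | hI =>
    rcases hI with h | h
    · exact ⟨0, 1, 0, 0, 0, 0, 0, 0, by push_cast; rw [h]; ring⟩
    · exact ⟨0, -1, 0, 0, 0, 0, 0, 0, by push_cast; rw [h]; ring⟩
  | hroot => exact ⟨0, 0, 1, 0, 0, 0, 0, 0, by push_cast; rw [hθ]; ring⟩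
  | hrat q => exact ⟨q, 0, 0, 0, 0, 0, 0, 0, by push_cast; ring⟩
  | hadd x y hx hy =>
    obtain ⟨a₀, a₁, a₂, a₃, a₄, a₅, a₆, a₇, rfl⟩ := hx
    obtain ⟨b₀, b₁, b₂, b₃, b₄, b₅, b₆, b₇, rfl⟩ := hy
    exact ⟨a₀ + b₀, a₁ + b₁, a₂ + b₂, a₃ + b₃, a₄ + b₄, a₅ + b₅, a₆ + b₆, a₇ + b₇, by
      push_cast; ring⟩
  | hmul x y hx hy =>
    obtain ⟨a₀, a₁, a₂, a₃, a₄, a₅, a₆, a₇, rfl⟩ := hx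
    obtain ⟨b₀, b₁, b₂, b₃, b₄, b₅, b₆, b₇, rfl⟩ := hy
    refine ⟨
      a₀ * b₀ - a₁ * b₁ + m * a₂ * b₆ - m * a₃ * b₇ + m * a₄ * b₄ - m * a₅ * b₅ + m * a₆ * b₂ -
        m * a₇ * b₃,
      a₀ * b₁ + a₁ * b₀ + m * a₂ * b₇ + m * a₃ * b₆ + m * a₄ * b₅ + m * a₅ * b₄ + m * a₆ * b₃ +
        m * a₇ * b₂,
      a₀ * b₂ - a₁ * b₃ + a₂ * b₀ - a₃ * b₁ + m * a₄ * b₆ - m * a₅ * b₇ + m * a₆ * b₄ - m * a₇ * b₅,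
      a₀ * b₃ + a₁ * b₂ + a₂ * b₁ + a₃ * b₀ + m * a₄ * b₇ + m * a₅ * b₆ + m * a₆ * b₅ + m * a₇ * b₄,
      a₀ * b₄ - a₁ * b₅ + a₂ * b₂ - a₃ * b₃ + a₄ * b₀ - a₅ * b₁ + m * a₆ * b₆ - m * a₇ * b₇,
      a₀ * b₅ + a₁ * b₄ + a₂ * b₃ + a₃ * b₂ + a₄ * b₁ + a₅ * b₀ + m * a₆ * b₇ + m * a₇ * b₆,
      a₀ * b₆ - a₁ * b₇ + a₂ * b₄ - a₃ * b₅ + a₄ * b₂ - a₅ * b₃ + a₆ * b₀ - a₇ * b₁,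
      a₀ * b₇ + a₁ * b₆ + a₂ * b₅ + a₃ * b₄ + a₄ * b₃ + a₅ * b₂ + a₆ * b₁ + a₇ * b₀,
      ?_⟩
    push_cast
    linear_combination
      (θ ^ 0 * (a₁ * b₁)
        + θ ^ 1 * (a₁ * b₃ + a₃ * b₁)
        + θ ^ 2 * (a₁ * b₅ + a₃ * b₃ + a₅ * b₁)
        + θ ^ 3 * (a₁ * b₇ + a₃ * b₅ + a₅ * b₃ + a₇ * b₁)
        + θ ^ 0 * m * (a₃ * b₇ + a₅ * b₅ + a₇ * b₃)
        + θ ^ 1 * m * (a₅ * b₇ + a₇ * b₅)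
        + θ ^ 2 * m * (a₇ * b₇)) * hJ
      + (θ ^ 0 * ((a₂ + a₃ * J) * (b₆ + b₇ * J) + (a₄ + a₅ * J) * (b₄ + b₅ * J) +
          (a₆ + a₇ * J) * (b₂ + b₃ * J))
        + θ ^ 1 * ((a₄ + a₅ * J) * (b₆ + b₇ * J) + (a₆ + a₇ * J) * (b₄ + b₅ * J))
        + θ ^ 2 * ((a₆ + a₇ * J) * (b₆ + b₇ * J))) * h4

theorem Kfield.normal (m : ℕ) : Normal ℚ (Kfield m) := by
  have hI := Kfield.I_sq m
  have hθ := Kfield.root_pow m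
  set J := Kfield.I m with hJ
  set θ := Kfield.root m with hθ'
  have hp : ((X ^ 2 + 1) * (X ^ 4 - C (m : ℚ))).map (algebraMap ℚ (Kfield m)) =
      (X - C J) * (X - C (-J)) *
        ((X - C θ) * (X - C (-θ)) * ((X - C (J * θ)) * (X - C (-(J * θ))))) := by
    have hI' : (C J : (Kfield m)[X]) ^ 2 = -1 := by rw [← C_pow, hI]; simp
    have hθ'' : (C θ : (Kfield m)[X]) ^ 4 = (m : (Kfield m)[X]) := by rw [← C_pow, hθ]; simp
    simp only [Polynomial.map_mul, Polynomial.map_add, Polynomial.map_sub, Polynomial.map_pow,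
      Polynomial.map_one, map_X, map_natCast, Polynomial.map_natCast, C_mul, C_neg]
    linear_combination (X ^ 2 + 1) * hθ'' + (X ^ 4 - C θ ^ 4 + (1 + C J ^ 2) *
      (C θ ^ 4 - C θ ^ 2 * X ^ 2) - (X ^ 2 + 1) * (C θ ^ 4 - C θ ^ 2 * X ^ 2)) * hI'
  have hne : ((X ^ 2 + 1) * (X ^ 4 - C (m : ℚ))) ≠ 0 := by
    refine mul_ne_zero ?_ (X_pow_sub_C_ne_zero (by norm_num) _)
    simpa using X_pow_add_C_ne_zero (R := ℚ) (n := 2) (by norm_num) 1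
  have : ((X ^ 2 + 1) * (X ^ 4 - C (m : ℚ))).IsSplittingField ℚ (Kfield m) := by
    refine ⟨?_, ?_⟩
    · rw [hp]
      exact ((Splits.X_sub_C _).mul (Splits.X_sub_C _)).mul
        (((Splits.X_sub_C _).mul (Splits.X_sub_C _)).mul
          ((Splits.X_sub_C _).mul (Splits.X_sub_C _)))
    · refine eq_top_iff.mpr fun x _ => ?_
      induction x using Kfield.induction with
      | hI =>
        refine Algebra.subset_adjoin ((mem_rootSet.mpr ⟨hne, ?_⟩))
        simp [← hJ, hI]
      | hroot =>
        refine Algebra.subset_adjoin ((mem_rootSet.mpr ⟨hne, ?_⟩))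
        simp [← hθ', hθ]
      | hrat q => exact Subalgebra.algebraMap_mem _ q
      | hadd x y hx hy => exact add_mem (hx trivial) (hy trivial)
      | hmul x y hx hy => exact mul_mem (hx trivial) (hy trivial)
  exact Normal.of_isSplittingField ((X ^ 2 + 1) * (X ^ 4 - C (m : ℚ)))

theorem Kfield.exists_conj (m : ℕ) : ∃ τ : Kfield m →+* Kfield m,
    τ (Kfield.I m) = -Kfield.I m ∧ τ (Kfield.root m) = Kfield.root m := by
  have := Kfield.normal m
  set σ : ℂ ≃ₐ[ℚ] ℂ := Complex.conjAe.restrictScalars ℚ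
  have h : ∀ x : Kfield m, ((σ.restrictNormal (Kfield m) x : Kfield m) : ℂ) =
      starRingEnd ℂ (x : ℂ) := fun x => σ.restrictNormal_commutes (Kfield m) x
  refine ⟨(σ.restrictNormal (Kfield m) : Kfield m →+* Kfield m), Subtype.ext ?_, Subtype.ext ?_⟩
  · exact (h _).trans Complex.conj_I
  · exact (h _).trans (Complex.conj_ofReal _)

theorem Kfield.exists_root_sq_neg {m : ℕ} (h : m % 4 = 3) : ∃ σ : Kfield m →+* Kfield m,
    σ (Kfield.root m ^ 2) = -Kfield.root m ^ 2 := by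
  have := Kfield.normal m
  have hirr : Irreducible (X ^ 2 - C (m : ℚ)) := by
    refine X_pow_sub_C_irreducible_of_prime Nat.prime_two fun b hb => ?_
    have hs : IsSquare (m : ℚ) := ⟨b, by rw [← hb, sq]⟩
    rw [Rat.isSquare_natCast_iff] at hs
    obtain ⟨n, rfl⟩ := hs
    have := Nat.mod_lt n (show 0 < 4 by norm_num)
    rw [Nat.mul_mod] at h
    interval_cases n % 4 <;> omega
  have hmin : minpoly ℚ (Kfield.root m ^ 2) = X ^ 2 - C (m : ℚ) := by
    refine (minpoly.eq_of_irreducible_of_monic hirr ?_ (monic_X_pow_sub_C _ (by norm_num))).symm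
    simp [← pow_mul, Kfield.root_pow]
  obtain ⟨σ, hσ⟩ := minpoly.exists_algEquiv_of_root' (K := ℚ) (L := Kfield m)
    (x := -Kfield.root m ^ 2) (y := Kfield.root m ^ 2)
    (Normal.isIntegral this _).isAlgebraic (by
      rw [hmin]; simp [← pow_mul, Kfield.root_pow])
  exact ⟨(σ : Kfield m →+* Kfield m), hσ⟩

theorem Kfield.nonempty_octicData {m : ℕ} (h : m % 4 = 3) : Nonempty (OcticData (Kfield m) m) := by
  obtain ⟨τ, hτI, hτθ⟩ := Kfield.exists_conj m
  have hI := Kfield.I_sq m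
  have hθ := Kfield.root_pow m
  have hθ0 : Kfield.root m ≠ 0 := by
    intro h0
    rw [h0] at hθ
    have : (m : Kfield m) ≠ 0 := by exact_mod_cast (by omega : m ≠ 0)
    exact this (by rw [← hθ]; norm_num)
  obtain ⟨ρ, hρI, hρθ⟩ : ∃ ρ : Kfield m →+* Kfield m,
      ρ (Kfield.I m) = Kfield.I m ∧ ρ (Kfield.root m ^ 2) = -Kfield.root m ^ 2 := by
    obtain ⟨σ, hσ⟩ := Kfield.exists_root_sq_neg h
    have h2 : σ (Kfield.I m) ^ 2 = Kfield.I m ^ 2 := by rw [← map_pow, hI, map_neg, map_one]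
    rcases sq_eq_sq_iff_eq_or_eq_neg.mp h2 with h2 | h2
    · exact ⟨σ, h2, hσ⟩
    · exact ⟨τ.comp σ, by simp [h2, hτI], by rw [RingHom.comp_apply, hσ, map_neg, map_pow, hτθ]⟩
  obtain ⟨J, hJ, hρθ'⟩ : ∃ J, (J = Kfield.I m ∨ J = -Kfield.I m) ∧
      ρ (Kfield.root m) = J * Kfield.root m := by
    have h2 : ρ (Kfield.root m) ^ 2 = (Kfield.I m * Kfield.root m) ^ 2 := by
      rw [← map_pow, hρθ, mul_pow, hI]; ring
    rcases sq_eq_sq_iff_eq_or_eq_neg.mp h2 with h2 | h2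
    · exact ⟨_, .inl rfl, h2⟩
    · exact ⟨_, .inr rfl, by rw [h2]; ring⟩
  have hJ2 : J ^ 2 = -1 := by
    rcases hJ with rfl | rfl
    · exact hI
    · rw [neg_sq, hI]
  exact ⟨
    { J := J
      θ := Kfield.root m
      ρ := ρ
      τ := τ
      J_sq := hJ2
      θ_pow := hθ
      ρ_J := by rcases hJ with rfl | rfl <;> simp [hρI]
      ρ_θ := hρθ'
      τ_J := by rcases hJ with rfl | rfl <;> simp [hτI]
      τ_θ := hτθ
      coords := Kfield.exists_coords hJ2 rfl hJ }⟩

end Kfield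

/-- If `α` generates the ring of integers, then `α - g α` divides every difference `x - g x`. -/
theorem NumberField.RingOfIntegers.sub_dvd_sub_of_adjoin_eq_top {L : Type*} [Field L]
    {α : 𝓞 L} (h : Algebra.adjoin ℤ ({α} : Set (𝓞 L)) = ⊤) (g : L →+* L) {x : L}
    (hx : IsIntegral ℤ x) : ∃ z, IsIntegral ℤ z ∧ x - g x = (α - g α) * z := by
  obtain ⟨x, rfl⟩ : ∃ y : 𝓞 L, (y : L) = x := ⟨⟨x, hx⟩, rfl⟩
  have hx' : x ∈ Algebra.adjoin ℤ ({α} : Set (𝓞 L)) := h ▸ Algebra.mem_top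
  rw [Algebra.adjoin_singleton_eq_range_aeval] at hx'
  obtain ⟨p, hp⟩ := hx'
  set β : 𝓞 L := ⟨g α, map_isIntegral_int g α.2⟩
  obtain ⟨z, hz⟩ := Polynomial.sub_dvd_eval_sub α β (p.map (algebraMap ℤ (𝓞 L)))
  have e : (x : L) = Polynomial.aeval (α : L) p := by
    have h1 : Polynomial.aeval α p = x := hp
    rw [Polynomial.aeval_algebraMap_apply, h1]
  have e' : g x = Polynomial.aeval (β : L) p := by
    rw [e]
    exact (Polynomial.aeval_algHom_apply g.toIntAlgHom (α : L) p).symm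
  refine ⟨z, z.2, ?_⟩
  have h2 := congrArg (algebraMap (𝓞 L) L) hz
  simp only [Polynomial.eval_map_algebraMap, map_sub, map_mul] at h2
  rw [e', e, Polynomial.aeval_algebraMap_apply, Polynomial.aeval_algebraMap_apply]
  exact h2

/-- For squarefree positive `m ≡ 3 (mod 4)`, the field `ℚ(i, m^(1/4))` is not monogenic. -/
theorem stmt_1 (m : ℕ) (hm : Squarefree m) (hpos : 0 < m) (h3 : m % 4 = 3) :
    ¬ ∃ α : 𝓞 (Kfield m), Algebra.adjoin ℤ ({α} : Set (𝓞 (Kfield m))) = ⊤ := by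
  rintro ⟨α, hα⟩
  obtain ⟨D⟩ := Kfield.nonempty_octicData h3
  exact D.not_generated (k := m / 4 + 1) (by omega) hm α.2
    fun g x hx => RingOfIntegers.sub_dvd_sub_of_adjoin_eq_top hα g hx
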